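/- Let 𝔤 be a simple Lie algebra of type D_4 over an algebraically closed field k of characteristic 0, with Cartan subalgebra 𝔥, base Π = {α_1, α_2, α_3, α_4} (α_2 the branch node), positive roots R_+, Killing form L, Borel subalgebra 𝔟 = 𝔥 ⊕ (⊕_{α ∈ R_+} 𝔤^α), and minimal parabolic subalgebra 𝔭 = k·X_{−α_2} + 𝔟. Fix nonzero root vectors X_α ∈ 𝔤^α, and set u = X_{−α_1} + X_{−α_3} + X_{−α_4} + X_{−(α_1 + 2α_2 + α_3 + α_4)}. For λ ∈ k, let f_λ ∈ 𝔭* be defined by f_λ(x) = L(λ X_{α_2} + u, x). Then for every λ ∈ k, dim 𝔭^{f_λ} = 1 and [𝔭, 𝔭^{f_λ}] ∩ 𝔭^{f_λ} ≠ {0}; indeed there exists h ∈ 𝔥 with α_1(h) = α_3(h) = α_4(h) = −α_2(h) = 1 such that [h, x] = x for every x ∈ 𝔭^{f_λ}. -/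

import Mathlib

open Finset Module

open scoped Classical

/-- A reduced crystallographic root system in the `k`-vector space `V`, recorded through
the finite set `roots` of roots, the coroot linear forms `corootForm α = ⟨·, α^∨⟩`, and
the integer Cartan pairing `pairInt β α = ⟨β, α^∨⟩ ∈ ℤ` (meaningful when `α, β` are roots). -/
structure RootSystemData (k V : Type*) [Field k] [CharZero k]
    [AddCommGroup V] [Module k V] where
  /-- the (finite) set of roots -/
  roots : Finset V
  /-- `corootForm α` is the linear form `⟨·, α^∨⟩` associated to the coroot of a root `α` -/
  corootForm : V → V →ₗ[k] k
  /-- the integer `⟨β, α^∨⟩`, recorded as `pairInt β α` -/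
  pairInt : V → V → ℤ
  ne_zero : ∀ α ∈ roots, α ≠ (0 : V)
  span_eq_top : Submodule.span k (roots : Set V) = ⊤
  pair_compat : ∀ α ∈ roots, ∀ β ∈ roots, ((pairInt β α : ℤ) : k) = corootForm α β
  pair_self : ∀ α ∈ roots, pairInt α α = 2
  reflect_mem : ∀ α ∈ roots, ∀ β ∈ roots, β - pairInt β α • α ∈ roots
  reduced : ∀ α ∈ roots, ∀ c : k, c • α ∈ roots → c = 1 ∨ c = -1

namespace RootSystemData

variable {k V : Type*} [Field k] [CharZero k] [AddCommGroup V] [Module k V]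
variable (P : RootSystemData k V)

/-- A base (set of simple roots) of the root system: a linearly independent set of roots
such that every root is a nonnegative or nonpositive integral combination of its elements. -/
structure IsBase (B : Finset V) : Prop where
  subset : B ⊆ P.roots
  indep : LinearIndependent k (fun b : B => (b : V))
  pos_or_neg : ∀ α ∈ P.roots,
    α ∈ AddSubmonoid.closure (B : Set V) ∨ -α ∈ AddSubmonoid.closure (B : Set V)

/-- The positive roots `R₊` with respect to a base `B`. -/
noncomputable def posRoots (B : Finset V) : Finset V :=
  P.roots.filter fun α => α ∈ AddSubmonoid.closure (B : Set V)

/-- `R^S = R ∩ ℤS`. -/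
noncomputable def rootsOf (S : Finset V) : Finset V :=
  P.roots.filter fun α => α ∈ AddSubgroup.closure (S : Set V)

/-- `R₊^S = R ∩ ℕS`. -/
noncomputable def posRootsOf (S : Finset V) : Finset V :=
  P.roots.filter fun α => α ∈ AddSubmonoid.closure (S : Set V)

/-- Two simple roots are linked in the Dynkin diagram of `S ⊆ Π` when they can be joined
by a chain in `S` of consecutively non-orthogonal elements. -/
def Linked (S : Finset V) : V → V → Prop :=
  Relation.ReflTransGen fun a b => a ∈ S ∧ b ∈ S ∧ P.pairInt a b ≠ 0

/-- A subset of a base is connected if its Dynkin diagram is connected (and nonempty). -/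
def IsConnected (S : Finset V) : Prop :=
  S.Nonempty ∧ ∀ a ∈ S, ∀ b ∈ S, P.Linked S a b

/-- `ε` is the highest root of `R^S`: a positive root of `R^S` such that `ε - α ∈ ℕS`
for every root `α ∈ R^S`. -/
def IsHighestRoot (S : Finset V) (ε : V) : Prop :=
  ε ∈ P.posRootsOf S ∧ ∀ α ∈ P.rootsOf S, ε - α ∈ AddSubmonoid.closure (S : Set V)

/-- The highest root `ε_S` of `R^S` (junk value `0` if it does not exist). -/
noncomputable def highestRoot (S : Finset V) : V :=
  if h : ∃ ε, P.IsHighestRoot S ε then h.choose else 0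

/-- The connected component of `a` in the Dynkin diagram of `S`. -/
noncomputable def component (S : Finset V) (a : V) : Finset V :=
  S.filter fun b => P.Linked S a b

/-- The connected components of the Dynkin diagram of `S`. -/
noncomputable def components (S : Finset V) : Finset (Finset V) :=
  S.image fun a => P.component S a

/-- `{α ∈ S : ⟨α, ε_S^∨⟩ = 0}`. -/
noncomputable def zeroPart (S : Finset V) : Finset V :=
  S.filter fun a => P.pairInt a (P.highestRoot S) = 0

/-- Fuel-based auxiliary recursion for the cascade `𝒦(S)`; for an actual root system the
recursion terminates in at most `card S` steps, so fuel `card S + 1` computes `𝒦(S)`. -/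
noncomputable def cascadeAux : ℕ → Finset V → Finset (Finset V)
  | 0, _ => ∅
  | n + 1, S => (P.components S).biUnion fun C => insert C (cascadeAux n (P.zeroPart C))

/-- The cascade `𝒦(S)`, defined recursively by `𝒦(∅) = ∅`,
`𝒦(S) = 𝒦(S₁) ∪ ⋯ ∪ 𝒦(S_r)` if `S` has connected components `S₁, …, S_r`, and
`𝒦(S) = {S} ∪ 𝒦({α ∈ S : ⟨α, ε_S^∨⟩ = 0})` if `S` is connected. -/
noncomputable def cascade (S : Finset V) : Finset (Finset V) :=
  P.cascadeAux (S.card + 1) S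

/-- `Γ^K = {α ∈ R^K : ⟨α, ε_K^∨⟩ > 0}`. -/
noncomputable def gamma (K : Finset V) : Finset V :=
  (P.rootsOf K).filter fun α => 0 < P.pairInt α (P.highestRoot K)

end RootSystemData

/-- For a Lie subalgebra `𝔮` of a Lie algebra and a linear form `f ∈ 𝔮*`, the subspace
`𝔮^f = {x ∈ 𝔮 : f ⁅x, y⁆ = 0 for all y ∈ 𝔮}`. -/
def lieSubFix {k g : Type*} [Field k] [LieRing g] [LieAlgebra k g]
    (q : LieSubalgebra k g) (f : Module.Dual k q) : Submodule k q where
  carrier := {x : q | ∀ y : q, f ⁅x, y⁆ = 0}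
  add_mem' := fun hx hy z => by rw [add_lie, map_add, hx z, hy z, add_zero]
  zero_mem' := fun z => by rw [zero_lie, map_zero]
  smul_mem' := fun c x hx z => by rw [smul_lie, map_smul, hx z, smul_zero]

/-- Coordinates (in the base) of the thirteen roots of the minimal parabolic of `D_4`. -/
def wD4 : Fin 13 → Fin 4 → ℤ :=
  ![![0, -1, 0, 0], ![1, 0, 0, 0], ![0, 0, 1, 0], ![0, 0, 0, 1], ![1, 2, 1, 1],
    ![0, 1, 0, 0], ![1, 1, 0, 0], ![0, 1, 1, 0], ![0, 1, 0, 1],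
    ![0, 1, 1, 1], ![1, 1, 0, 1], ![1, 1, 1, 0], ![1, 1, 1, 1]]

/-- The weights on which the form is supported. -/
def tD4 (n : Fin 4 → ℤ) : Prop :=
  n = wD4 0 ∨ n = wD4 1 ∨ n = wD4 2 ∨ n = wD4 3 ∨ n = wD4 4

instance (n : Fin 4 → ℤ) : Decidable (tD4 n) := by unfold tD4; infer_instance

/-- Positive roots of `D_4` in coordinates. -/
def qD4 (p q r s : ℤ) : Prop :=
  (p = 1 ∧ q = 0 ∧ r = 0 ∧ s = 0) ∨
  (p = 0 ∧ q = 0 ∧ r = 1 ∧ s = 0) ∨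
  (p = 0 ∧ q = 0 ∧ r = 0 ∧ s = 1) ∨
  (p = 1 ∧ q = 2 ∧ r = 1 ∧ s = 1) ∨
  (p = 0 ∧ q = 1 ∧ r = 0 ∧ s = 0) ∨
  (p = 1 ∧ q = 1 ∧ r = 0 ∧ s = 0) ∨
  (p = 0 ∧ q = 1 ∧ r = 1 ∧ s = 0) ∨
  (p = 0 ∧ q = 1 ∧ r = 0 ∧ s = 1) ∨
  (p = 0 ∧ q = 1 ∧ r = 1 ∧ s = 1) ∨
  (p = 1 ∧ q = 1 ∧ r = 0 ∧ s = 1) ∨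
  (p = 1 ∧ q = 1 ∧ r = 1 ∧ s = 0) ∨
  (p = 1 ∧ q = 1 ∧ r = 1 ∧ s = 1)

theorem qD4_s0 (p q r s : ℤ) (h0 : 0 ≤ p) (h : qD4 (q - p) q r s) : qD4 p q r s := by
  unfold qD4 at h
  rcases h with h | h | h | h | h | h | h | h | h | h | h | h <;>
    (obtain ⟨h1, h2, h3, h4⟩ := h; subst_vars; simp [qD4]; try omega)

theorem qD4_s1 (p q r s : ℤ) (h0 : 0 ≤ q) (h : qD4 p (p + r + s - q) r s) : qD4 p q r s := by
  unfold qD4 at h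
  rcases h with h | h | h | h | h | h | h | h | h | h | h | h <;>
    (obtain ⟨h1, h2, h3, h4⟩ := h; subst_vars; simp [qD4]; try omega)

theorem qD4_s2 (p q r s : ℤ) (h0 : 0 ≤ r) (h : qD4 p q (q - r) s) : qD4 p q r s := by
  unfold qD4 at h
  rcases h with h | h | h | h | h | h | h | h | h | h | h | h <;>
    (obtain ⟨h1, h2, h3, h4⟩ := h; subst_vars; simp [qD4]; try omega)

theorem qD4_s3 (p q r s : ℤ) (h0 : 0 ≤ s) (h : qD4 p q r (q - s)) : qD4 p q r s := by
  unfold qD4 at h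
  rcases h with h | h | h | h | h | h | h | h | h | h | h | h <;>
    (obtain ⟨h1, h2, h3, h4⟩ := h; subst_vars; simp [qD4]; try omega)

theorem D4_enum (S : ℤ → ℤ → ℤ → ℤ → Prop)
    (h0 : ∀ p q r s, S p q r s → S (q - p) q r s)
    (h1 : ∀ p q r s, S p q r s → S p (p + r + s - q) r s)
    (h2 : ∀ p q r s, S p q r s → S p q (q - r) s)
    (h3 : ∀ p q r s, S p q r s → S p q r (q - s))
    (hsign : ∀ p q r s, S p q r s → (0 ≤ p ∧ 0 ≤ q ∧ 0 ≤ r ∧ 0 ≤ s) ∨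
      (p ≤ 0 ∧ q ≤ 0 ∧ r ≤ 0 ∧ s ≤ 0))
    (hz : ¬ S 0 0 0 0)
    (c0 : ∀ c, S c 0 0 0 → c = 1 ∨ c = -1)
    (c1 : ∀ c, S 0 c 0 0 → c = 1 ∨ c = -1)
    (c2 : ∀ c, S 0 0 c 0 → c = 1 ∨ c = -1)
    (c3 : ∀ c, S 0 0 0 c → c = 1 ∨ c = -1) (N : ℕ) :
    ∀ p q r s : ℤ, p + q + r + s ≤ N → 0 ≤ p → 0 ≤ q → 0 ≤ r → 0 ≤ s → S p q r s →
      ∃ i : Fin 13, i ≠ 0 ∧ ![p, q, r, s] = wD4 i := by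
  suffices H : ∀ p q r s : ℤ, p + q + r + s ≤ N → 0 ≤ p → 0 ≤ q → 0 ≤ r → 0 ≤ s →
      S p q r s → qD4 p q r s by
    intro p q r s a1 a2 a3 a4 a5 a6
    rcases H p q r s a1 a2 a3 a4 a5 a6 with h | h | h | h | h | h | h | h | h | h | h | h <;>
      obtain ⟨rfl, rfl, rfl, rfl⟩ := h
    · exact ⟨1, by decide⟩
    · exact ⟨2, by decide⟩
    · exact ⟨3, by decide⟩
    · exact ⟨4, by decide⟩
    · exact ⟨5, by decide⟩
    · exact ⟨6, by decide⟩
    · exact ⟨7, by decide⟩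
    · exact ⟨8, by decide⟩
    · exact ⟨9, by decide⟩
    · exact ⟨10, by decide⟩
    · exact ⟨11, by decide⟩
    · exact ⟨12, by decide⟩
  induction N with
  | zero =>
    intro p q r s hN hp hq hr hs hS
    obtain ⟨rfl, rfl, rfl, rfl⟩ : p = 0 ∧ q = 0 ∧ r = 0 ∧ s = 0 := by
      refine ⟨?_, ?_, ?_, ?_⟩ <;> push_cast at hN <;> omega
    exact absurd hS hz
  | succ N ih =>
    intro p q r s hN hp hq hr hs hS
    push_cast at hN
    by_cases k0 : q < 2 * p
    · have hS' := h0 _ _ _ _ hS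
      rcases hsign _ _ _ _ hS' with h | h
      · have := ih _ _ _ _ (by omega) h.1 h.2.1 h.2.2.1 h.2.2.2 hS'
        exact qD4_s0 _ _ _ _ hp this
      · obtain ⟨rfl, rfl, rfl⟩ : q = 0 ∧ r = 0 ∧ s = 0 := by omega
        have := c0 _ hS
        obtain rfl : p = 1 := by omega
        simp [qD4]
    by_cases k2 : q < 2 * r
    · have hS' := h2 _ _ _ _ hS
      rcases hsign _ _ _ _ hS' with h | h
      · have := ih _ _ _ _ (by omega) h.1 h.2.1 h.2.2.1 h.2.2.2 hS'
        exact qD4_s2 _ _ _ _ hr this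
      · obtain ⟨rfl, rfl, rfl⟩ : q = 0 ∧ p = 0 ∧ s = 0 := by omega
        have := c2 _ hS
        obtain rfl : r = 1 := by omega
        simp [qD4]
    by_cases k3 : q < 2 * s
    · have hS' := h3 _ _ _ _ hS
      rcases hsign _ _ _ _ hS' with h | h
      · have := ih _ _ _ _ (by omega) h.1 h.2.1 h.2.2.1 h.2.2.2 hS'
        exact qD4_s3 _ _ _ _ hs this
      · obtain ⟨rfl, rfl, rfl⟩ : q = 0 ∧ p = 0 ∧ r = 0 := by omega
        have := c3 _ hS
        obtain rfl : s = 1 := by omega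
        simp [qD4]
    by_cases k1 : p + r + s < 2 * q
    · have hS' := h1 _ _ _ _ hS
      rcases hsign _ _ _ _ hS' with h | h
      · have := ih _ _ _ _ (by omega) h.1 h.2.1 h.2.2.1 h.2.2.2 hS'
        exact qD4_s1 _ _ _ _ hq this
      · obtain ⟨rfl, rfl, rfl⟩ : p = 0 ∧ r = 0 ∧ s = 0 := by omega
        have := c1 _ hS
        obtain rfl : q = 1 := by omega
        simp [qD4]
    obtain ⟨rfl, rfl, rfl, rfl⟩ : p = 0 ∧ q = 0 ∧ r = 0 ∧ s = 0 := by omega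
    exact absurd hS hz

theorem D4_core {k V H : Type*} [Field k] [AddCommGroup V] [Module k V]
    [AddCommGroup H] [Module k H] (B : V →ₗ[k] V →ₗ[k] k) (hB : ∀ x, B x x = 0)
    (ι : H →ₗ[k] V) (a : Fin 4 → H →ₗ[k] k) (hd : Fin 4 → H)
    (h2 : (2 : k) ≠ 0)
    (hdual : ∀ i j, a i (hd j) = if i = j then 1 else 0)
    (ha : ∀ h, (∀ i, a i h = 0) → h = 0)
    (e : Fin 13 → V) (φ : Fin 13 → k)
    (hN : ∀ i j, ¬ tD4 (wD4 i + wD4 j) → B (e i) (e j) = 0)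
    (hH : ∀ h j, B (ι h) (e j) = (∑ i, (wD4 j i : k) * a i h) * φ j)
    (hHH : ∀ h h', B (ι h) (ι h') = 0)
    (hφ : ∀ j, ¬ tD4 (wD4 j) → φ j = 0)
    (φ1 : φ 1 ≠ 0) (φ2 : φ 2 ≠ 0) (φ3 : φ 3 ≠ 0) (φ4 : φ 4 ≠ 0)
    (n0 : B (e 5) (e 12) ≠ 0) (n1 : B (e 6) (e 9) ≠ 0) (n2 : B (e 7) (e 10) ≠ 0)
    (n3 : B (e 8) (e 11) ≠ 0) :
    ∃ b : Fin 13 → k, b 0 = 1 ∧ b 5 = 0 ∧ b 6 = 0 ∧ b 7 = 0 ∧ b 8 = 0 ∧ b 12 = 0 ∧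
      (∀ j, B (∑ i, b i • e i) (e j) = 0) ∧ (∀ h, B (∑ i, b i • e i) (ι h) = 0) ∧
      ∀ h c, (∀ j, B (ι h + ∑ i, c i • e i) (e j) = 0) →
        (∀ h', B (ι h + ∑ i, c i • e i) (ι h') = 0) → h = 0 ∧ c = c 0 • b := by
  have hskew : ∀ x y, B x y = - B y x := by
    intro x y
    have := hB (x + y)
    simp only [map_add, LinearMap.add_apply, hB] at this
    linear_combination this
  have hH' : ∀ h j, B (e j) (ι h) = -((∑ i, (wD4 j i : k) * a i h) * φ j) := by
    intro h j; rw [hskew, hH]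
  have φz : φ 5 = 0 ∧ φ 6 = 0 ∧ φ 7 = 0 ∧ φ 8 = 0 ∧ φ 9 = 0 ∧ φ 10 = 0 ∧ φ 11 = 0 ∧ φ 12 = 0 := by
    refine ⟨?_, ?_, ?_, ?_, ?_, ?_, ?_, ?_⟩ <;> exact hφ _ (by decide)
  obtain ⟨z5, z6, z7, z8, z9, z10, z11, z12⟩ := φz
  -- the sum formulas
  have E : ∀ c : Fin 13 → k, ∀ s : Fin 13 → Prop, ∀ [DecidablePred s], ∀ j, (∀ i, ¬ s i → ¬ tD4 (wD4 i + wD4 j)) →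
      B (∑ i, c i • e i) (e j) = ∑ i, (if s i then c i * B (e i) (e j) else 0) := by
    intro c s _ j hs
    simp only [map_sum, LinearMap.sum_apply, map_smul, LinearMap.smul_apply, smul_eq_mul]
    refine Finset.sum_congr rfl fun i _ => ?_
    split_ifs with h
    · rfl
    · rw [hN _ _ (hs i h), mul_zero]
  have E0 : ∀ c : Fin 13 → k, ∀ j, (∀ i, ¬ tD4 (wD4 i + wD4 j)) →
      B (∑ i, c i • e i) (e j) = 0 := by
    intro c j hs
    rw [E c (fun _ => False) j (fun i _ => hs i)]
    simp
  have E1 : ∀ c : Fin 13 → k, ∀ i₁ j, (∀ i, ¬ (i = i₁) → ¬ tD4 (wD4 i + wD4 j)) →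
      B (∑ i, c i • e i) (e j) = c i₁ * B (e i₁) (e j) := by
    intro c i₁ j hs
    rw [E c (fun i => i = i₁) j hs]
    simp
  have E2 : ∀ c : Fin 13 → k, ∀ i₁ j, i₁ ≠ 0 → (∀ i, ¬ (i = 0 ∨ i = i₁) → ¬ tD4 (wD4 i + wD4 j)) →
      B (∑ i, c i • e i) (e j) = c 0 * B (e 0) (e j) + c i₁ * B (e i₁) (e j) := by
    intro c i₁ j hne hs
    rw [E c (fun i => i = 0 ∨ i = i₁) j hs]
    rw [← Finset.sum_subset (Finset.subset_univ {0, i₁})]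
    · rw [Finset.sum_pair (Ne.symm hne)]; simp
    · intro x _ hx
      simp at hx
      simp [hx]
  have F0 : ∀ c : Fin 13 → k, c 6 = 0 → c 7 = 0 → c 8 = 0 → B (∑ i, c i • e i) (e 0) = 0 := by
    intro c h6 h7 h8
    rw [E c (fun i => i = 6 ∨ i = 7 ∨ i = 8) 0 (by decide)]
    refine Finset.sum_eq_zero fun i _ => ?_
    split_ifs with h
    · rcases h with rfl | rfl | rfl <;> simp [h6, h7, h8]
    · rfl
  have hw0 : ∀ h, (∑ i, (wD4 0 i : k) * a i h) = - a 1 h := by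
    intro h; simp [wD4, Fin.sum_univ_four]
  have hw1 : ∀ h, (∑ i, (wD4 1 i : k) * a i h) = a 0 h := by
    intro h; simp [wD4, Fin.sum_univ_four]
  have hw2 : ∀ h, (∑ i, (wD4 2 i : k) * a i h) = a 2 h := by
    intro h; simp [wD4, Fin.sum_univ_four]
  have hw3 : ∀ h, (∑ i, (wD4 3 i : k) * a i h) = a 3 h := by
    intro h; simp [wD4, Fin.sum_univ_four]
  have hw4 : ∀ h, (∑ i, (wD4 4 i : k) * a i h) = a 0 h + 2 * a 1 h + a 2 h + a 3 h := by
    intro h; simp [wD4, Fin.sum_univ_four]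
  have G : ∀ c : Fin 13 → k, ∀ h, B (∑ i, c i • e i) (ι h) =
      -(c 0 * (-a 1 h) * φ 0 + c 1 * a 0 h * φ 1 + c 2 * a 2 h * φ 2 + c 3 * a 3 h * φ 3 +
        c 4 * (a 0 h + 2 * a 1 h + a 2 h + a 3 h) * φ 4) := by
    intro c h
    simp only [map_sum, LinearMap.sum_apply, map_smul, LinearMap.smul_apply, smul_eq_mul]
    have : ∀ i : Fin 13, ¬ (i = 0 ∨ i = 1 ∨ i = 2 ∨ i = 3 ∨ i = 4) → ¬ tD4 (wD4 i) := by decide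
    rw [← Finset.sum_subset (Finset.subset_univ {0, 1, 2, 3, 4})]
    · rw [Finset.sum_insert (by decide), Finset.sum_insert (by decide),
        Finset.sum_insert (by decide), Finset.sum_insert (by decide), Finset.sum_singleton]
      rw [hH', hH', hH', hH', hH', hw0, hw1, hw2, hw3, hw4]
      ring
    · intro x _ hx
      rw [hH', hφ x (this x (by simpa using hx))]
      simp
  have dec1 : ∀ i : Fin 13, ¬ (i = 12) → ¬ tD4 (wD4 i + wD4 5) := by decide
  have dec2 : ∀ i : Fin 13, ¬ (i = 5) → ¬ tD4 (wD4 i + wD4 12) := by decide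
  have dec6 : ∀ i : Fin 13, ¬ (i = 0 ∨ i = 9) → ¬ tD4 (wD4 i + wD4 6) := by decide
  have dec7 : ∀ i : Fin 13, ¬ (i = 0 ∨ i = 10) → ¬ tD4 (wD4 i + wD4 7) := by decide
  have dec8 : ∀ i : Fin 13, ¬ (i = 0 ∨ i = 11) → ¬ tD4 (wD4 i + wD4 8) := by decide
  have dec9 : ∀ i : Fin 13, ¬ (i = 6) → ¬ tD4 (wD4 i + wD4 9) := by decide
  have dec10 : ∀ i : Fin 13, ¬ (i = 7) → ¬ tD4 (wD4 i + wD4 10) := by decide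
  have dec11 : ∀ i : Fin 13, ¬ (i = 8) → ¬ tD4 (wD4 i + wD4 11) := by decide
  have s1 : ∀ i : Fin 13, ¬ tD4 (wD4 i + wD4 1) := by decide
  have s2 : ∀ i : Fin 13, ¬ tD4 (wD4 i + wD4 2) := by decide
  have s3 : ∀ i : Fin 13, ¬ tD4 (wD4 i + wD4 3) := by decide
  have s4 : ∀ i : Fin 13, ¬ tD4 (wD4 i + wD4 4) := by decide
  have m9 : B (e 9) (e 6) ≠ 0 := by rw [hskew]; exact neg_ne_zero.mpr n1
  have m10 : B (e 10) (e 7) ≠ 0 := by rw [hskew]; exact neg_ne_zero.mpr n2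
  have m11 : B (e 11) (e 8) ≠ 0 := by rw [hskew]; exact neg_ne_zero.mpr n3
  have m12 : B (e 12) (e 5) ≠ 0 := by rw [hskew]; exact neg_ne_zero.mpr n0
  let t : k := φ 0 / (2 * φ 4)
  have ht : 2 * t * φ 4 = φ 0 := by simp only [t]; field_simp
  let b : Fin 13 → k := ![1, -t * φ 4 / φ 1, -t * φ 4 / φ 2, -t * φ 4 / φ 3, t, 0, 0, 0, 0,
    -B (e 0) (e 6) / B (e 9) (e 6), -B (e 0) (e 7) / B (e 10) (e 7),
    -B (e 0) (e 8) / B (e 11) (e 8), 0]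
  have b0 : b 0 = 1 := rfl
  have b1 : b 1 = -t * φ 4 / φ 1 := rfl
  have b2 : b 2 = -t * φ 4 / φ 2 := rfl
  have b3 : b 3 = -t * φ 4 / φ 3 := rfl
  have b4 : b 4 = t := rfl
  have b5 : b 5 = 0 := rfl
  have b6 : b 6 = 0 := rfl
  have b7 : b 7 = 0 := rfl
  have b8 : b 8 = 0 := rfl
  have b9 : b 9 = -B (e 0) (e 6) / B (e 9) (e 6) := rfl
  have b10 : b 10 = -B (e 0) (e 7) / B (e 10) (e 7) := rfl
  have b11 : b 11 = -B (e 0) (e 8) / B (e 11) (e 8) := rfl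
  have b12 : b 12 = 0 := rfl
  clear_value b t
  refine ⟨b, b0, b5, b6, b7, b8, b12, ?_, ?_, ?_⟩
  · intro j
    have : j = 0 ∨ j = 1 ∨ j = 2 ∨ j = 3 ∨ j = 4 ∨ j = 5 ∨ j = 6 ∨ j = 7 ∨ j = 8 ∨ j = 9 ∨ j = 10 ∨
      j = 11 ∨ j = 12 := by revert j; decide
    rcases this with rfl | rfl | rfl | rfl | rfl | rfl | rfl | rfl | rfl | rfl | rfl | rfl | rfl
    · exact F0 b b6 b7 b8
    · exact E0 b 1 s1
    · exact E0 b 2 s2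
    · exact E0 b 3 s3
    · exact E0 b 4 s4
    · rw [E1 b 12 5 dec1, b12, zero_mul]
    · rw [E2 b 9 6 (by decide) dec6, b0, b9, div_mul_cancel₀ _ m9]; ring
    · rw [E2 b 10 7 (by decide) dec7, b0, b10, div_mul_cancel₀ _ m10]; ring
    · rw [E2 b 11 8 (by decide) dec8, b0, b11, div_mul_cancel₀ _ m11]; ring
    · rw [E1 b 6 9 dec9, b6, zero_mul]
    · rw [E1 b 7 10 dec10, b7, zero_mul]
    · rw [E1 b 8 11 dec11, b8, zero_mul]
    · rw [E1 b 5 12 dec2, b5, zero_mul]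
  · intro h
    have p1 : b 1 * φ 1 = -t * φ 4 := by rw [b1, div_mul_cancel₀ _ φ1]
    have p2 : b 2 * φ 2 = -t * φ 4 := by rw [b2, div_mul_cancel₀ _ φ2]
    have p3 : b 3 * φ 3 = -t * φ 4 := by rw [b3, div_mul_cancel₀ _ φ3]
    rw [G, b0, b4]
    linear_combination -a 0 h * p1 - a 2 h * p2 - a 3 h * p3 - a 1 h * ht
  · intro h c hc hc'
    have hs : ∀ j, (∑ i, (wD4 j i : k) * a i h) * φ j + B (∑ i, c i • e i) (e j) = 0 := by
      intro j; rw [← hH, ← hc j, map_add, LinearMap.add_apply]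
    have hs' : ∀ h', B (∑ i, c i • e i) (ι h') = 0 := by
      intro h'
      have := hc' h'
      rwa [map_add, LinearMap.add_apply, hHH, zero_add] at this
    have a0 : a 0 h = 0 := by
      have := hs 1
      rw [hw1, E0 c 1 s1, add_zero] at this
      exact (mul_eq_zero.mp this).resolve_right φ1
    have a2 : a 2 h = 0 := by
      have := hs 2
      rw [hw2, E0 c 2 s2, add_zero] at this
      exact (mul_eq_zero.mp this).resolve_right φ2
    have a3 : a 3 h = 0 := by
      have := hs 3
      rw [hw3, E0 c 3 s3, add_zero] at this
      exact (mul_eq_zero.mp this).resolve_right φ3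
    have a1 : a 1 h = 0 := by
      have := hs 4
      rw [hw4, E0 c 4 s4, add_zero, a0, a2, a3] at this
      have := (mul_eq_zero.mp this).resolve_right φ4
      simpa [h2] using this
    have h0 : h = 0 := ha h (by intro i; fin_cases i <;> assumption)
    refine ⟨h0, ?_⟩
    have hs : ∀ j, B (∑ i, c i • e i) (e j) = 0 := by
      intro j
      have := hs j
      simpa [h0] using this
    have c12 : c 12 = 0 := by
      have := hs 5
      rw [E1 c 12 5 dec1] at this
      exact (mul_eq_zero.mp this).resolve_right m12
    have c5 : c 5 = 0 := by
      have := hs 12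
      rw [E1 c 5 12 dec2] at this
      exact (mul_eq_zero.mp this).resolve_right n0
    have c6 : c 6 = 0 := by
      have := hs 9
      rw [E1 c 6 9 dec9] at this
      exact (mul_eq_zero.mp this).resolve_right n1
    have c7 : c 7 = 0 := by
      have := hs 10
      rw [E1 c 7 10 dec10] at this
      exact (mul_eq_zero.mp this).resolve_right n2
    have c8 : c 8 = 0 := by
      have := hs 11
      rw [E1 c 8 11 dec11] at this
      exact (mul_eq_zero.mp this).resolve_right n3
    have c9 : c 9 = c 0 * b 9 := by
      have := hs 6
      rw [E2 c 9 6 (by decide) dec6] at this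
      rw [b9]; field_simp; linear_combination this
    have c10 : c 10 = c 0 * b 10 := by
      have := hs 7
      rw [E2 c 10 7 (by decide) dec7] at this
      rw [b10]; field_simp; linear_combination this
    have c11 : c 11 = c 0 * b 11 := by
      have := hs 8
      rw [E2 c 11 8 (by decide) dec8] at this
      rw [b11]; field_simp; linear_combination this
    have g0 := hs' (hd 0)
    have g1 := hs' (hd 1)
    have g2 := hs' (hd 2)
    have g3 := hs' (hd 3)
    rw [G] at g0 g1 g2 g3
    simp [hdual] at g0 g1 g2 g3
    have c4 : c 4 = c 0 * b 4 := by
      have : (2 * φ 4) * (c 4 - c 0 * t) = 0 := by linear_combination -g1 - c 0 * ht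
      rw [b4]
      exact sub_eq_zero.mp ((mul_eq_zero.mp this).resolve_left (mul_ne_zero h2 φ4))
    rw [b4] at c4
    have c1 : c 1 = c 0 * b 1 := by
      rw [b1]; field_simp; linear_combination -g0 - φ 4 * c4
    have c2 : c 2 = c 0 * b 2 := by
      rw [b2]; field_simp; linear_combination -g2 - φ 4 * c4
    have c3 : c 3 = c 0 * b 3 := by
      rw [b3]; field_simp; linear_combination -g3 - φ 4 * c4
    rw [← b4] at c4
    have c0 : c 0 = c 0 * b 0 := by rw [b0, mul_one]
    rw [← mul_zero (c 0), ← b5] at c5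
    rw [← mul_zero (c 0), ← b6] at c6
    rw [← mul_zero (c 0), ← b7] at c7
    rw [← mul_zero (c 0), ← b8] at c8
    rw [← mul_zero (c 0), ← b12] at c12
    funext j
    fin_cases j <;> assumption
section D4Lie

open LieAlgebra LieModule LieAlgebra.IsKilling

variable {k g : Type*} [Field k] [IsAlgClosed k] [CharZero k]
    [LieRing g] [LieAlgebra k g] [FiniteDimensional k g] [LieAlgebra.IsSimple k g]
    {H : LieSubalgebra k g} [H.IsCartanSubalgebra]

theorem D4_root_smul {α : Module.Dual k H} (hα : α ≠ 0) (hb : rootSpace H ⇑α ≠ ⊥) {x y : g}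
    (hx : x ∈ rootSpace H ⇑α) (hx0 : x ≠ 0) (hy : y ∈ rootSpace H ⇑α) : ∃ c : k, y = c • x := by
  let A : Weight k H g := ⟨⇑α, hb⟩
  have hA : A.IsNonZero := by
    intro h
    apply hα
    ext z
    exact congrFun h z
  have h1 := finrank_rootSpace_eq_one A hA
  obtain ⟨c, hc⟩ := (finrank_eq_one_iff_of_nonzero' (⟨x, hx⟩ : rootSpace H ⇑A)
    (by simpa [Subtype.ext_iff] using hx0)).mp h1 ⟨y, hy⟩
  exact ⟨c, by simpa using (congrArg Subtype.val hc).symm⟩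

theorem D4_killing_ne {α : Module.Dual k H} (hα : α ≠ 0) (hb : rootSpace H ⇑α ≠ ⊥) {x y : g}
    (hx : x ∈ rootSpace H ⇑α) (hx0 : x ≠ 0) (hy : y ∈ rootSpace H ⇑(-α)) (hy0 : y ≠ 0) :
    killingForm k g y x ≠ 0 := by
  intro h0
  have hb' : rootSpace H ⇑(-α) ≠ ⊥ := by
    intro h; rw [h] at hy; exact hy0 (by simpa using hy)
  have : x ∈ LinearMap.ker (killingForm k g) := by
    refine mem_ker_killingForm_of_mem_rootSpace_of_forall_rootSpace_neg k g H hx ?_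
    intro z hz
    obtain ⟨c, rfl⟩ := D4_root_smul (neg_ne_zero.mpr hα) hb' hy hy0 (y := z) (by simpa using hz)
    rw [LieModule.traceForm_comm, map_smul, LinearMap.smul_apply, h0, smul_zero]
  rw [ker_killingForm_eq_bot] at this
  exact hx0 (by simpa using this)

theorem D4_lie_ne {α β : Module.Dual k H} (hα : α ≠ 0) (hb : rootSpace H ⇑α ≠ ⊥)
    (hab : rootSpace H ⇑(α + β) ≠ ⊥) (hba : rootSpace H ⇑(β - α) = ⊥) {x y : g}
    (hx : x ∈ rootSpace H ⇑α) (hx0 : x ≠ 0) (hy : y ∈ rootSpace H ⇑β) (hy0 : y ≠ 0) :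
    ⁅x, y⁆ ≠ 0 := by
  intro h0
  have hb' : rootSpace H ⇑β ≠ ⊥ := by
    intro h; rw [h] at hy; exact hy0 (by simpa using hy)
  let A : Weight k H g := ⟨⇑α, hb⟩
  let C : Weight k H g := ⟨⇑β, hb'⟩
  have hA : A.IsNonZero := by
    intro h
    apply hα
    ext z
    exact congrFun h z
  obtain ⟨h, e, f, t, he, hf⟩ := exists_isSl2Triple_of_weight_isNonZero hA
  have hh := t.h_eq_coroot hA he hf
  obtain ⟨c, rfl⟩ := D4_root_smul hα hb hx hx0 he
  have hn : ∃ n : ℕ, C (coroot A) = n := by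
    have P : t.HasPrimitiveVectorWith y (C (coroot A)) :=
      { ne_zero := hy0
        lie_h := by
          rw [hh]
          exact lie_eq_smul_of_mem_rootSpace hy (coroot A)
        lie_e := by rw [smul_lie, h0, smul_zero] }
    exact P.exists_nat
  obtain ⟨n, hn⟩ := hn
  rw [apply_coroot_eq_cast] at hn
  have hn' : (chainBotCoeff A C - chainTopCoeff A C : ℤ) = n := by exact_mod_cast hn
  have i1 := (rootSpace_zsmul_add_ne_bot_iff A C hA 1).mp (by
    have : (1 : ℤ) • (⇑A : H → k) + ⇑C = ⇑(α + β) := by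
      rw [one_smul]; rfl
    rw [this]; exact hab)
  have i2 := (rootSpace_zsmul_add_ne_bot_iff A C hA (-1)).not.mp (by
    have : (-1 : ℤ) • (⇑A : H → k) + ⇑C = ⇑(β - α) := by
      rw [neg_smul, one_smul, neg_add_eq_sub]; rfl
    rw [this, not_not]; exact hba)
  omega

theorem D4_killing_zero {α β : Module.Dual k H} {x y : g}
    (hx : x ∈ rootSpace H ⇑α) (hy : y ∈ rootSpace H ⇑β) (h : α + β ≠ 0) :
    killingForm k g x y = 0 := by
  refine killingForm_apply_eq_zero_of_mem_rootSpace_of_add_ne_zero k g H hx hy ?_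
  intro h'
  apply h
  ext z
  exact congrFun h' z

theorem D4_lie_mem {α β : Module.Dual k H} {x y : g}
    (hx : x ∈ rootSpace H ⇑α) (hy : y ∈ rootSpace H ⇑β) : ⁅x, y⁆ ∈ rootSpace H ⇑(α + β) := by
  have := lie_mem_genWeightSpace_of_mem_genWeightSpace hx hy
  exact this

end D4Lie

section LieTheory

open LieAlgebra

/-- The Cartan matrix of type `D_4`, with the branch node in position `1`
(corresponding to the Bourbaki simple root `α_2`, linked to the other three). -/
def cartanD4 : Fin 4 → Fin 4 → ℤ := fun i j =>
  if i = j then 2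
  else if i = 1 ∨ j = 1 then -1
  else 0

section D4Roots

variable {k V : Type*} [Field k] [CharZero k] [AddCommGroup V] [Module k V]

/-- The weight with integer coordinates `n`. -/
def wtD4 (a : Fin 4 → V) (n : Fin 4 → ℤ) : V := ∑ i, n i • a i

theorem wtD4_add (a : Fin 4 → V) (m n : Fin 4 → ℤ) : wtD4 a (m + n) = wtD4 a m + wtD4 a n := by
  simp [wtD4, add_smul, Finset.sum_add_distrib]

theorem wtD4_neg (a : Fin 4 → V) (m : Fin 4 → ℤ) : wtD4 a (-m) = -wtD4 a m := by
  simp [wtD4]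

theorem wtD4_inj {a : Fin 4 → V} (ha : LinearIndependent k a) :
    Function.Injective (wtD4 a) := by
  intro m n h
  have h' : ∑ i, ((m i : k) - n i) • a i = 0 := by
    simp only [sub_smul, Finset.sum_sub_distrib, Int.cast_smul_eq_zsmul]
    exact sub_eq_zero.mpr h
  funext i
  have := Fintype.linearIndependent_iff.mp ha _ h' i
  exact_mod_cast sub_eq_zero.mp this

theorem D4_linInd (P : RootSystemData k V) (a : Fin 4 → V) (hinj : Function.Injective a)
    (hbase : P.IsBase (Finset.image a Finset.univ)) : LinearIndependent k a := by
  have h := hbase.indep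
  let f : Fin 4 → (Finset.image a Finset.univ : Finset V) := fun i => ⟨a i, by simp⟩
  exact h.comp f (fun i j hij => hinj (congrArg Subtype.val hij))

theorem D4_closure (a : Fin 4 → V) {α : V}
    (h : α ∈ AddSubmonoid.closure ((Finset.image a Finset.univ : Finset V) : Set V)) :
    ∃ n : Fin 4 → ℤ, (∀ i, 0 ≤ n i) ∧ α = wtD4 a n := by
  induction h using AddSubmonoid.closure_induction with
  | mem x hx =>
    simp at hx
    obtain ⟨i, rfl⟩ := hx
    refine ⟨Pi.single i 1, ?_, ?_⟩
    · intro j; by_cases h : j = i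
      · subst h; simp
      · simp [h]
    · simp [wtD4, Pi.single_apply]
  | zero => exact ⟨0, by simp, by simp [wtD4]⟩
  | add x y _ _ hx hy =>
    obtain ⟨m, hm, rfl⟩ := hx
    obtain ⟨n, hn, rfl⟩ := hy
    exact ⟨m + n, fun i => add_nonneg (hm i) (hn i), (wtD4_add a m n).symm⟩

theorem D4_closure' (a : Fin 4 → V) (n : Fin 4 → ℤ) (hn : ∀ i, 0 ≤ n i) :
    wtD4 a n ∈ AddSubmonoid.closure ((Finset.image a Finset.univ : Finset V) : Set V) := by
  refine sum_mem fun i _ => ?_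
  obtain ⟨m, hm⟩ := Int.eq_ofNat_of_zero_le (hn i)
  rw [hm]
  simp only [natCast_zsmul]
  exact nsmul_mem (AddSubmonoid.subset_closure (by simp)) _

theorem D4_single (a : Fin 4 → V) (i : Fin 4) : wtD4 a (Pi.single i 1) = a i := by
  simp [wtD4, Pi.single_apply]

theorem D4_thirteen (S : ℤ → ℤ → ℤ → ℤ → Prop)
    (r0 : ∀ p q r s, S p q r s → S (q - p) q r s)
    (r1 : ∀ p q r s, S p q r s → S p (p + r + s - q) r s)
    (r2 : ∀ p q r s, S p q r s → S p q (q - r) s)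
    (r3 : ∀ p q r s, S p q r s → S p q r (q - s))
    (s0 : S 1 0 0 0) (s1 : S 0 1 0 0) (s2 : S 0 0 1 0) (s3 : S 0 0 0 1) (i : Fin 13) :
    S (wD4 i 0) (wD4 i 1) (wD4 i 2) (wD4 i 3) := by
  have t0 : S 1 1 0 0 := by simpa using r0 0 1 0 0 s1
  have t2 : S 0 1 1 0 := by simpa using r2 0 1 0 0 s1
  have t3 : S 0 1 0 1 := by simpa using r3 0 1 0 0 s1
  have v0 : S 0 1 1 1 := by simpa using r3 _ _ _ _ t2
  have v2 : S 1 1 0 1 := by simpa using r3 _ _ _ _ t0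
  have v3 : S 1 1 1 0 := by simpa using r2 _ _ _ _ t0
  have w1 : S 1 1 1 1 := by simpa using r0 _ _ _ _ v0
  have w2 : S 1 2 1 1 := by simpa using r1 _ _ _ _ w1
  have m : S 0 (-1) 0 0 := by simpa using r1 _ _ _ _ s1
  fin_cases i <;> assumption

set_option maxHeartbeats 1000000 in
theorem D4_roots (P : RootSystemData k V) (a : Fin 4 → V) (hinj : Function.Injective a)
    (hbase : P.IsBase (Finset.image a Finset.univ))
    (hcartan : ∀ i j, P.pairInt (a i) (a j) = cartanD4 i j) :
    (∀ i : Fin 13, wtD4 a (wD4 i) ∈ P.roots) ∧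
    (∀ n, wtD4 a n ∈ P.roots → wtD4 a (-n) ∈ P.roots) ∧
    (∀ n, wtD4 a n ∈ P.roots → ∃ i : Fin 13, i ≠ 0 ∧ (n = wD4 i ∨ n = -wD4 i)) ∧
    (∀ α ∈ P.posRoots (Finset.image a Finset.univ), ∃ i : Fin 13, i ≠ 0 ∧ α = wtD4 a (wD4 i)) := by
  have hind := D4_linInd P a hinj hbase
  have hwi := wtD4_inj hind
  have har : ∀ i, a i ∈ P.roots := fun i => hbase.subset (by simp)
  have hneg : ∀ n, wtD4 a n ∈ P.roots → wtD4 a (-n) ∈ P.roots := by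
    intro n hn
    have := P.reflect_mem _ hn _ hn
    rw [P.pair_self _ hn] at this
    rw [wtD4_neg]
    convert this using 1
    rw [two_smul]; abel
  -- pairing of an integral combination with a simple root
  have hpair : ∀ n j, wtD4 a n ∈ P.roots → P.pairInt (wtD4 a n) (a j) = ∑ i, n i * cartanD4 i j := by
    intro n j hn
    have h1 := P.pair_compat _ (har j) _ hn
    have h2 : P.corootForm (a j) (wtD4 a n) = ((∑ i, n i * cartanD4 i j : ℤ) : k) := by
      simp only [wtD4, map_sum, map_zsmul, Int.cast_sum, Int.cast_mul]
      refine Finset.sum_congr rfl fun i _ => ?_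
      rw [← P.pair_compat _ (har j) _ (har i), hcartan, zsmul_eq_mul]
    rw [h2] at h1
    exact_mod_cast h1
  have hrefl : ∀ n j, wtD4 a n ∈ P.roots →
      wtD4 a (n - (∑ i, n i * cartanD4 i j) • Pi.single j 1) ∈ P.roots := by
    intro n j hn
    have h1 := P.reflect_mem _ (har j) _ hn
    rw [hpair n j hn] at h1
    convert h1 using 1
    rw [sub_eq_add_neg, wtD4_add, wtD4_neg, ← sub_eq_add_neg]
    congr 1
    conv_rhs => rw [← D4_single a j]
    simp only [wtD4, Finset.smul_sum, smul_smul]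
    rfl
  have hsgn : ∀ n, wtD4 a n ∈ P.roots → (∀ i, 0 ≤ n i) ∨ (∀ i, n i ≤ 0) := by
    intro n hn
    rcases hbase.pos_or_neg _ hn with h | h
    · obtain ⟨m, hm, he⟩ := D4_closure a h
      rw [hwi he]; exact Or.inl hm
    · obtain ⟨m, hm, he⟩ := D4_closure a h
      rw [← wtD4_neg] at he
      right
      intro i
      have := hm i
      rw [← hwi he] at this
      simpa using this
  have hred : ∀ (j : Fin 4) (c : ℤ) n, n = Pi.single j c → wtD4 a n ∈ P.roots →
      c = 1 ∨ c = -1 := by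
    intro j c n hn h
    have e : wtD4 a n = (c : k) • a j := by
      subst hn
      simp [wtD4, Pi.single_apply, Int.cast_smul_eq_zsmul]
    rw [e] at h
    have := P.reduced _ (har j) _ h
    rcases this with h | h
    · left; exact_mod_cast h
    · right; exact_mod_cast h
  let S : ℤ → ℤ → ℤ → ℤ → Prop := fun p q r s => wtD4 a ![p, q, r, s] ∈ P.roots
  have r0 : ∀ p q r s, S p q r s → S (q - p) q r s := by
    intro p q r s h
    have := hrefl _ 0 h
    convert this using 2
    funext i; fin_cases i <;> simp [Fin.sum_univ_four, cartanD4]; ring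
  have r1 : ∀ p q r s, S p q r s → S p (p + r + s - q) r s := by
    intro p q r s h
    have := hrefl _ 1 h
    convert this using 2
    funext i; fin_cases i <;> simp [Fin.sum_univ_four, cartanD4]; ring
  have r2 : ∀ p q r s, S p q r s → S p q (q - r) s := by
    intro p q r s h
    have := hrefl _ 2 h
    convert this using 2
    funext i; fin_cases i <;> simp [Fin.sum_univ_four, cartanD4]; ring
  have r3 : ∀ p q r s, S p q r s → S p q r (q - s) := by
    intro p q r s h
    have := hrefl _ 3 h
    convert this using 2
    funext i; fin_cases i <;> simp [Fin.sum_univ_four, cartanD4]; ring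
  have hz : ¬ S 0 0 0 0 := by
    intro h
    apply P.ne_zero _ h
    simp [wtD4, Fin.sum_univ_four]
  have enum := D4_enum S r0 r1 r2 r3
    (by
      intro p q r s h
      rcases hsgn _ h with h | h
      · exact Or.inl ⟨h 0, h 1, h 2, h 3⟩
      · exact Or.inr ⟨h 0, h 1, h 2, h 3⟩) hz
    (fun c h => hred 0 c _ (by funext i; fin_cases i <;> simp) h)
    (fun c h => hred 1 c _ (by funext i; fin_cases i <;> simp) h)
    (fun c h => hred 2 c _ (by funext i; fin_cases i <;> simp) h)
    (fun c h => hred 3 c _ (by funext i; fin_cases i <;> simp) h)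
  have hvec : ∀ n : Fin 4 → ℤ, n = ![n 0, n 1, n 2, n 3] := by
    intro n; funext i; fin_cases i <;> rfl
  have hpos : ∀ n, wtD4 a n ∈ P.roots → (∀ i, 0 ≤ n i) → ∃ i : Fin 13, i ≠ 0 ∧ n = wD4 i := by
    intro n hn h
    have := enum (n 0 + n 1 + n 2 + n 3).toNat (n 0) (n 1) (n 2) (n 3) (by omega) (h 0) (h 1) (h 2)
      (h 3) (by simp only [S]; rw [← hvec]; exact hn)
    rwa [← hvec] at this
  refine ⟨?_, hneg, ?_, ?_⟩
  · have s0 : S 1 0 0 0 := by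
      simp only [S]; convert har 0; simp [wtD4, Fin.sum_univ_four]
    have s1 : S 0 1 0 0 := by
      simp only [S]; convert har 1; simp [wtD4, Fin.sum_univ_four]
    have s2 : S 0 0 1 0 := by
      simp only [S]; convert har 2; simp [wtD4, Fin.sum_univ_four]
    have s3 : S 0 0 0 1 := by
      simp only [S]; convert har 3; simp [wtD4, Fin.sum_univ_four]
    have key := D4_thirteen S r0 r1 r2 r3 s0 s1 s2 s3
    intro i
    have := key i
    simp only [S] at this
    rwa [← hvec] at this
  · intro n hn
    rcases hsgn n hn with h | h
    · obtain ⟨i, hi, e⟩ := hpos n hn h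
      exact ⟨i, hi, Or.inl e⟩
    · obtain ⟨i, hi, e⟩ := hpos (-n) (hneg n hn) (by intro i; simpa using h i)
      exact ⟨i, hi, Or.inr (by rw [← e, neg_neg])⟩
  · intro α hα
    simp only [RootSystemData.posRoots, Finset.mem_filter] at hα
    obtain ⟨n, hn, rfl⟩ := D4_closure a hα.2
    obtain ⟨i, hi, e⟩ := hpos n hα.1 hn
    exact ⟨i, hi, by rw [e]⟩

end D4Roots

set_option maxHeartbeats 4000000 in
/-- Let `𝔤` be a simple Lie algebra of type `D_4` over an algebraically
closed field `k` of characteristic `0`, with Cartan subalgebra `𝔥`, base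
`Π = {α_1, α_2, α_3, α_4}` (`α_2` the branch node; here `α_i = a (i-1)`), positive roots
`R₊`, Killing form `L`, Borel subalgebra `𝔟 = 𝔥 ⊕ (⊕_{α ∈ R₊} 𝔤^α)`, and minimal parabolic
subalgebra `𝔭 = k·X_{-α_2} + 𝔟`.  Fix nonzero root vectors `X_α ∈ 𝔤^α` and set
`u = X_{-α_1} + X_{-α_3} + X_{-α_4} + X_{-(α_1+2α_2+α_3+α_4)}`.  For `λ ∈ k`, let
`f_λ ∈ 𝔭*` be given by `f_λ x = L (λ X_{α_2} + u, x)`.  Then for every `λ ∈ k` one has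
`dim 𝔭^{f_λ} = 1` and `[𝔭, 𝔭^{f_λ}] ∩ 𝔭^{f_λ} ≠ {0}`; indeed there exists `h ∈ 𝔥` with
`α_1 h = α_3 h = α_4 h = -α_2 h = 1` such that `⁅h, x⁆ = x` for every `x ∈ 𝔭^{f_λ}`. -/
theorem parabolic_of_D4_has_no_stable_form
    (k g : Type*) [Field k] [IsAlgClosed k] [CharZero k]
    [LieRing g] [LieAlgebra k g] [FiniteDimensional k g] [LieAlgebra.IsSimple k g]
    (H : LieSubalgebra k g) [H.IsCartanSubalgebra]
    (P : RootSystemData k (Module.Dual k H))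
    (hroots : ∀ α : Module.Dual k H, α ∈ P.roots ↔ α ≠ 0 ∧ rootSpace H ⇑α ≠ ⊥)
    (a : Fin 4 → Module.Dual k H) (hinj : Function.Injective a)
    (Δ : Finset (Module.Dual k H)) (hΔ : Δ = Finset.image a Finset.univ)
    (hbase : P.IsBase Δ)
    (hcartan : ∀ i j, P.pairInt (a i) (a j) = cartanD4 i j)
    (X : Module.Dual k H → g)
    (hX : ∀ α ∈ P.roots, X α ∈ rootSpace H ⇑α ∧ X α ≠ 0)
    (u : g) (hu : u = X (-a 0) + X (-a 2) + X (-a 3) + X (-(a 0 + 2 • a 1 + a 2 + a 3)))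
    (p : LieSubalgebra k g)
    (hp : p.toSubmodule = Submodule.span k {X (-a 1)} ⊔ H.toSubmodule ⊔
      ⨆ α ∈ P.posRoots Δ, (rootSpace H ⇑α).toSubmodule)
    (f : k → Module.Dual k p)
    (hf : ∀ (l : k) (x : p), f l x = killingForm k g (l • X (a 1) + u) (x : g)) :
    ∀ l : k,
      Module.finrank k ↥(lieSubFix p (f l)) = 1 ∧
      Submodule.span k {z : p | ∃ x : p, ∃ y ∈ lieSubFix p (f l), z = ⁅x, y⁆} ⊓
          lieSubFix p (f l) ≠ ⊥ ∧
      ∃ h : H, a 0 h = 1 ∧ a 2 h = 1 ∧ a 3 h = 1 ∧ a 1 h = -1 ∧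
        ∀ x : p, x ∈ lieSubFix p (f l) → ⁅(h : g), (x : g)⁆ = (x : g) := by
  subst hΔ
  intro l
  have hind := D4_linInd P a hinj hbase
  have hwi := wtD4_inj hind
  obtain ⟨hR, hneg, hR3, hR4⟩ := D4_roots P a hinj hbase hcartan
  have hsp : ⊤ ≤ Submodule.span k (Set.range a) := by
    rw [← P.span_eq_top, Submodule.span_le]
    have hw : ∀ n, wtD4 a n ∈ Submodule.span k (Set.range a) := fun n =>
      sum_mem fun i _ => zsmul_mem (Submodule.subset_span (Set.mem_range_self i)) _
    intro α hα
    rcases hbase.pos_or_neg _ hα with h | h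
    · obtain ⟨n, -, e⟩ := D4_closure a h
      rw [e]; exact hw n
    · obtain ⟨n, -, e⟩ := D4_closure a h
      rw [neg_eq_iff_eq_neg.mp e]; exact neg_mem (hw n)
  let bs : Basis (Fin 4) k (Module.Dual k H) := Basis.mk hind hsp
  let hd : Fin 4 → H := fun j => (Module.evalEquiv k H).symm (bs.coord j)
  have hdual : ∀ i j, a i (hd j) = if i = j then 1 else 0 := by
    intro i j
    have h1 : a i (hd j) = bs.coord j (a i) := by
      simp only [hd]
      rw [Module.apply_evalEquiv_symm_apply]
    have h2 : a i = bs i := by simp [bs]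
    rw [h1, h2, Basis.coord_apply, Basis.repr_self, Finsupp.single_apply]
  have ha0 : ∀ h : H, (∀ i, a i h = 0) → h = 0 := by
    intro h hh
    rw [← Module.forall_dual_apply_eq_zero_iff k]
    intro F
    have hF : F ∈ Submodule.span k (Set.range a) := hsp trivial
    induction hF using Submodule.span_induction with
    | mem x hx => obtain ⟨i, rfl⟩ := hx; exact hh i
    | zero => rfl
    | add x y _ _ hx hy => simp [hx, hy]
    | smul c x _ hx => simp [hx]
  have hwR : ∀ i, X (wtD4 a (wD4 i)) ∈ rootSpace H ⇑(wtD4 a (wD4 i)) ∧ X (wtD4 a (wD4 i)) ≠ 0 :=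
    fun i => hX _ (hR i)
  have hwN : ∀ i, X (wtD4 a (-wD4 i)) ∈ rootSpace H ⇑(wtD4 a (-wD4 i)) ∧
      X (wtD4 a (-wD4 i)) ≠ 0 := fun i => hX _ (hneg _ (hR i))
  have hwn : ∀ i, wtD4 a (wD4 i) ≠ 0 ∧ rootSpace H ⇑(wtD4 a (wD4 i)) ≠ ⊥ :=
    fun i => (hroots _).mp (hR i)
  let e : Fin 13 → g := fun i => X (wtD4 a (wD4 i))
  have w0 : wtD4 a (-wD4 0) = a 1 := by simp [wtD4, wD4, Fin.sum_univ_four]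
  have w0' : wtD4 a (wD4 0) = -a 1 := by simp [wtD4, wD4, Fin.sum_univ_four]
  have w1 : wtD4 a (-wD4 1) = -a 0 := by simp [wtD4, wD4, Fin.sum_univ_four]
  have w2 : wtD4 a (-wD4 2) = -a 2 := by simp [wtD4, wD4, Fin.sum_univ_four]
  have w3 : wtD4 a (-wD4 3) = -a 3 := by simp [wtD4, wD4, Fin.sum_univ_four]
  have w4 : wtD4 a (-wD4 4) = -(a 0 + 2 • a 1 + a 2 + a 3) := by
    rw [wtD4_neg]; congr 1
    simp [wtD4, wD4, Fin.sum_univ_four]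
    rw [← natCast_zsmul]; rfl
  have hξ : l • X (a 1) + u = l • X (wtD4 a (-wD4 0)) + (X (wtD4 a (-wD4 1)) +
      X (wtD4 a (-wD4 2)) + X (wtD4 a (-wD4 3)) + X (wtD4 a (-wD4 4))) := by
    rw [hu, w0, w1, w2, w3, w4]
  have Z : ∀ (j : Fin 13) (n : Fin 4 → ℤ) (y : g), y ∈ rootSpace H ⇑(wtD4 a n) → n ≠ wD4 j →
      killingForm k g (X (wtD4 a (-wD4 j))) y = 0 := by
    intro j n y hy hn
    refine D4_killing_zero (hwN j).1 hy ?_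
    intro h
    rw [wtD4_neg, neg_add_eq_zero] at h
    exact hn (hwi h).symm
  have NE : ∀ (j : Fin 13) (y : g), y ∈ rootSpace H ⇑(wtD4 a (wD4 j)) → y ≠ 0 →
      killingForm k g (X (wtD4 a (-wD4 j))) y ≠ 0 := by
    intro j y hy hy0
    refine D4_killing_ne (hwn j).1 (hwn j).2 hy hy0 ?_ (hwN j).2
    have := (hwN j).1
    rwa [wtD4_neg] at this ⊢
  generalize hξ' : l • X (a 1) + u = ξ at *
  have K0 : ∀ n y, y ∈ rootSpace H ⇑(wtD4 a n) → ¬ tD4 n → killingForm k g ξ y = 0 := by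
    intro n y hy hn
    simp only [tD4, not_or] at hn
    obtain ⟨m0, m1, m2, m3, m4⟩ := hn
    rw [hξ]
    simp only [map_add, map_smul, LinearMap.add_apply, LinearMap.smul_apply, Z _ n y hy m0,
      Z _ n y hy m1, Z _ n y hy m2, Z _ n y hy m3, Z _ n y hy m4]
    simp
  have K1 : ∀ y, y ∈ rootSpace H ⇑(wtD4 a (wD4 1)) → y ≠ 0 → killingForm k g ξ y ≠ 0 := by
    intro y hy hy0
    rw [hξ]
    simp only [map_add, map_smul, LinearMap.add_apply, LinearMap.smul_apply,
      Z 0 _ y hy (by decide), Z 2 _ y hy (by decide), Z 3 _ y hy (by decide),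
      Z 4 _ y hy (by decide)]
    simpa using NE 1 y hy hy0
  have K2 : ∀ y, y ∈ rootSpace H ⇑(wtD4 a (wD4 2)) → y ≠ 0 → killingForm k g ξ y ≠ 0 := by
    intro y hy hy0
    rw [hξ]
    simp only [map_add, map_smul, LinearMap.add_apply, LinearMap.smul_apply,
      Z 0 _ y hy (by decide), Z 1 _ y hy (by decide), Z 3 _ y hy (by decide),
      Z 4 _ y hy (by decide)]
    simpa using NE 2 y hy hy0
  have K3 : ∀ y, y ∈ rootSpace H ⇑(wtD4 a (wD4 3)) → y ≠ 0 → killingForm k g ξ y ≠ 0 := by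
    intro y hy hy0
    rw [hξ]
    simp only [map_add, map_smul, LinearMap.add_apply, LinearMap.smul_apply,
      Z 0 _ y hy (by decide), Z 1 _ y hy (by decide), Z 2 _ y hy (by decide),
      Z 4 _ y hy (by decide)]
    simpa using NE 3 y hy hy0
  have K4 : ∀ y, y ∈ rootSpace H ⇑(wtD4 a (wD4 4)) → y ≠ 0 → killingForm k g ξ y ≠ 0 := by
    intro y hy hy0
    rw [hξ]
    simp only [map_add, map_smul, LinearMap.add_apply, LinearMap.smul_apply,
      Z 0 _ y hy (by decide), Z 1 _ y hy (by decide), Z 2 _ y hy (by decide),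
      Z 3 _ y hy (by decide)]
    simpa using NE 4 y hy hy0
  have NB : ∀ i j : Fin 13, wD4 i + wD4 j = wD4 4 →
      (∀ m : Fin 13, wD4 j - wD4 i ≠ wD4 m ∧ wD4 j - wD4 i ≠ -wD4 m) → wD4 j - wD4 i ≠ 0 →
      killingForm k g ξ ⁅e i, e j⁆ ≠ 0 := by
    intro i j hij hm hz
    have hab : wtD4 a (wD4 i) + wtD4 a (wD4 j) = wtD4 a (wD4 4) := by rw [← wtD4_add, hij]
    have hmem := D4_lie_mem (hwR i).1 (hwR j).1
    rw [hab] at hmem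
    refine K4 _ hmem ?_
    refine D4_lie_ne (hwn i).1 (hwn i).2 (by rw [hab]; exact (hwn 4).2) ?_ (hwR i).1 (hwR i).2
      (hwR j).1 (hwR j).2
    by_contra hb
    have hs : wtD4 a (wD4 j) - wtD4 a (wD4 i) = wtD4 a (wD4 j - wD4 i) := by
      rw [sub_eq_add_neg, sub_eq_add_neg, wtD4_add, wtD4_neg]
    rw [hs] at hb
    have hz0 : wtD4 a (wD4 j - wD4 i) ≠ 0 := by
      intro h
      apply hz
      apply hwi
      rw [h]; simp [wtD4]
    obtain ⟨m, -, h | h⟩ := hR3 _ ((hroots _).mpr ⟨hz0, hb⟩)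
    · exact (hm m).1 h
    · exact (hm m).2 h
  let B : g →ₗ[k] g →ₗ[k] k :=
    LinearMap.mk₂ k (fun x y => killingForm k g ξ ⁅x, y⁆)
      (by intros; simp) (by intros; simp) (by intros; simp) (by intros; simp)
  have Bap : ∀ x y, B x y = killingForm k g ξ ⁅x, y⁆ := fun x y => rfl
  let φ : Fin 13 → k := fun j => killingForm k g ξ (e j)
  have hHe : ∀ (h : H) j, ⁅(h : g), e j⁆ = (∑ i, (wD4 j i : k) * a i h) • e j := by
    intro h j
    have := LieAlgebra.IsKilling.lie_eq_smul_of_mem_rootSpace (hwR j).1 h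
    rw [LieSubalgebra.coe_bracket_of_module] at this
    rw [this]
    congr 1
    simp [wtD4, LinearMap.sum_apply]
  obtain ⟨b, b0, b5, b6, b7, b8, b12, hbe, hbH, huniq⟩ := D4_core (k := k) (H := H) B
    (fun x => by rw [Bap, lie_self, map_zero]) H.toSubmodule.subtype a hd two_ne_zero hdual ha0 e φ
    (by
      intro i j h
      have hmem := D4_lie_mem (hwR i).1 (hwR j).1
      rw [← wtD4_add] at hmem
      exact K0 _ _ hmem h)
    (by
      intro h j
      rw [Bap]
      have := hHe h j
      erw [this]
      rw [map_smul, smul_eq_mul])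
    (by
      intro (h : H) (h' : H)
      rw [Bap]
      have : ⁅h, h'⁆ = 0 := trivial_lie_zero _ _ h h'
      have h3 : ⁅(h : g), (h' : g)⁆ = 0 := by
        rw [← LieSubalgebra.coe_bracket, this]; rfl
      erw [h3]
      rw [map_zero])
    (fun j h => K0 _ _ (hwR j).1 h)
    (K1 _ (hwR 1).1 (hwR 1).2) (K2 _ (hwR 2).1 (hwR 2).2) (K3 _ (hwR 3).1 (hwR 3).2)
    (K4 _ (hwR 4).1 (hwR 4).2)
    (NB 5 12 (by decide) (by decide) (by decide)) (NB 6 9 (by decide) (by decide) (by decide))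
    (NB 7 10 (by decide) (by decide) (by decide)) (NB 8 11 (by decide) (by decide) (by decide))
  -- structure of `p`
  have hHp : ∀ h : H, (h : g) ∈ p := by
    intro h
    change (h : g) ∈ p.toSubmodule
    rw [hp]
    exact Submodule.mem_sup_left (Submodule.mem_sup_right h.2)
  have hep : ∀ i, e i ∈ p := by
    intro i
    change e i ∈ p.toSubmodule
    rw [hp]
    by_cases hi : i = 0
    · subst hi
      refine Submodule.mem_sup_left (Submodule.mem_sup_left ?_)
      simp only [e, w0']
      exact Submodule.mem_span_singleton_self _
    · refine Submodule.mem_sup_right ?_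
      refine Submodule.mem_iSup_of_mem (wtD4 a (wD4 i)) (Submodule.mem_iSup_of_mem ?_ (hwR i).1)
      simp only [RootSystemData.posRoots, Finset.mem_filter]
      refine ⟨hR i, D4_closure' a _ ?_⟩
      revert hi
      revert i
      decide
  have hple : p.toSubmodule ≤ H.toSubmodule ⊔ Submodule.span k (Set.range e) := by
    rw [hp]
    refine sup_le (sup_le ?_ le_sup_left) ?_
    · rw [Submodule.span_singleton_le_iff_mem]
      refine Submodule.mem_sup_right (Submodule.subset_span ⟨0, ?_⟩)
      simp only [e, w0']
    · refine iSup₂_le fun α hα => ?_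
      obtain ⟨i, -, rfl⟩ := hR4 α hα
      intro y hy
      obtain ⟨c, rfl⟩ := D4_root_smul (hwn i).1 (hwn i).2 (hwR i).1 (hwR i).2 hy
      exact Submodule.mem_sup_right (Submodule.smul_mem _ _ (Submodule.subset_span ⟨i, rfl⟩))
  have hdec : ∀ x ∈ p, ∃ (h : H) (c : Fin 13 → k), x = (h : g) + ∑ i, c i • e i := by
    intro x hx
    obtain ⟨y, hy, z, hz, rfl⟩ := Submodule.mem_sup.mp (hple hx)
    obtain ⟨c, rfl⟩ := (Submodule.mem_span_range_iff_exists_fun k).mp hz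
    exact ⟨⟨y, hy⟩, c, rfl⟩
  have hv0 : (∑ i, b i • e i) ≠ 0 := by
    intro h
    have h1 : killingForm k g (X (wtD4 a (-wD4 0))) (∑ i, b i • e i) = 0 := by rw [h, map_zero]
    have h2 : ∀ i : Fin 13, i ≠ 0 → killingForm k g (X (wtD4 a (-wD4 0))) (e i) = 0 := by
      intro i hi
      refine Z 0 _ _ (hwR i).1 ?_
      revert hi
      revert i
      decide
    rw [map_sum, Finset.sum_eq_single 0 (fun i _ hi => by rw [map_smul, h2 i hi, smul_zero])
      (fun h => absurd (Finset.mem_univ _) h), b0, one_smul] at h1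
    exact NE 0 _ (hwR 0).1 (hwR 0).2 h1
  have hvp : (∑ i, b i • e i) ∈ p := sum_mem fun i _ => p.smul_mem _ (hep i)
  have hfix : ∀ x : p, x ∈ lieSubFix p (f l) ↔ ∀ y : p, B x y = 0 := by
    intro x
    change (∀ y : p, f l ⁅x, y⁆ = 0) ↔ _
    refine forall_congr' fun y => ?_
    rw [hf, hξ', Bap]; rfl
  let v : p := ⟨∑ i, b i • e i, hvp⟩
  have hvfix : v ∈ lieSubFix p (f l) := by
    rw [hfix]
    intro y
    obtain ⟨h, c, hy⟩ := hdec y y.2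
    rw [hy, map_add]
    have h1 : B (v : g) (h : g) = 0 := hbH h
    have h2 : ∀ i, B (v : g) (e i) = 0 := hbe
    rw [h1, zero_add, map_sum (B (v : g))]
    refine Finset.sum_eq_zero fun i _ => ?_
    rw [map_smul, h2, smul_zero]
  have hall : ∀ x : p, x ∈ lieSubFix p (f l) → ∃ c : k, x = c • v := by
    intro x hx
    rw [hfix] at hx
    obtain ⟨h, c, hxe⟩ := hdec x x.2
    have := huniq h c (fun j => by
        have := hx ⟨e j, hep j⟩
        rw [hxe] at this
        exact this) (fun h' => by
        have := hx ⟨h', hHp h'⟩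
        rw [hxe] at this
        exact this)
    obtain ⟨rfl, hc⟩ := this
    refine ⟨c 0, Subtype.ext ?_⟩
    rw [hxe, hc]
    simp [v, b0, Finset.smul_sum, smul_smul]
  have hvne : v ≠ 0 := fun h => hv0 (congrArg Subtype.val h)
  let h : H := hd 0 - hd 1 + hd 2 + hd 3
  have ah0 : a 0 h = 1 := by simp [h, hdual]
  have ah1 : a 1 h = -1 := by simp [h, hdual]
  have ah2 : a 2 h = 1 := by simp [h, hdual]
  have ah3 : a 3 h = 1 := by simp [h, hdual]
  have hhv : ⁅(h : g), (v : g)⁆ = (v : g) := by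
    have hbb : ∀ i, (∑ j, (wD4 i j : k) * a j h) * b i = b i := by
      intro i
      simp only [Fin.sum_univ_four, ah0, ah1, ah2, ah3]
      fin_cases i <;> simp [wD4, b5, b6, b7, b8, b12] <;> norm_num
    change ⁅(h : g), ∑ i, b i • e i⁆ = ∑ i, b i • e i
    rw [lie_sum]
    refine Finset.sum_congr rfl fun i _ => ?_
    rw [lie_smul, hHe, smul_smul, mul_comm, hbb]
  refine ⟨?_, ?_, h, ah0, ah2, ah3, ah1, ?_⟩
  · refine finrank_eq_one (⟨v, hvfix⟩ : lieSubFix p (f l))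
      (fun hh => hvne (congrArg Subtype.val hh)) ?_
    rintro ⟨x, hx⟩
    obtain ⟨c, rfl⟩ := hall x hx
    exact ⟨c, rfl⟩
  · intro hbot
    have hmem : v ∈ Submodule.span k {z : p | ∃ x : p, ∃ y ∈ lieSubFix p (f l), z = ⁅x, y⁆} ⊓
        lieSubFix p (f l) := by
      refine ⟨Submodule.subset_span ⟨⟨h, hHp h⟩, v, hvfix, ?_⟩, hvfix⟩
      exact Subtype.ext hhv.symm
    rw [hbot] at hmem
    exact hvne (by simpa using hmem)
  · intro x hx
    obtain ⟨c, rfl⟩ := hall x hx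
    change ⁅(h : g), c • (v : g)⁆ = c • (v : g)
    rw [lie_smul, hhv]

end LieTheory
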